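/- Let x(t,ε) be a C² family with ∂_t x = ξ_0(x,t) + η_p ξ_p(x) and ∂_ε x = ω_p ξ_p(x), such that along ε = 0 the constraints η_α = φ_α(η_i, x, t) hold and the Chetaev conditions ω_α = (∂φ_α/∂η_i) ω_i hold for all t ∈ [t₁, t₂]. Then, with all quantities evaluated along ε = 0 and δη_p := ∂_ε η_p|_{ε=0}, the first variation of the action satisfies the identity ∫_{t₁}^{t₂} ( (∂L/∂η_p) δη_p + ω_p X_p L ) dt = [ (∂L*/∂η_j) ω_j ]_{t₁}^{t₂} − ∫_{t₁}^{t₂} [ d/dt(∂L*/∂η_j) − (K_{0j}^k + K_{qj}^k η_q) ∂L*/∂η_k − X*_j L* − (A_j^α)* (∂L/∂η_α)* ] ω_j dt. -/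

import Mathlib

open scoped BigOperators

namespace NNH

/-- Full index type for `p, q, r = 1,…,n`: `Sum.inl i` are the independent
indices `i, j, k = 1,…,m` and `Sum.inr α` the dependent ones
`α, β = m+1,…,n` (so `n = m + κ`). -/
abbrev Idx (m κ : ℕ) := Fin m ⊕ Fin κ

variable {m κ : ℕ}

/-- Partial derivative of `f : (ι → ℝ) → ℝ` in the `i`-th coordinate at `v`. -/
noncomputable def pd {ι : Type*} [DecidableEq ι] (f : (ι → ℝ) → ℝ) (i : ι) (v : ι → ℝ) : ℝ :=
  deriv (fun s => f (Function.update v i s)) (v i)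

/-- The operator `X_p G = ξ_p^q ∂G/∂x_q` (differentiation in `x` only). -/
noncomputable def Xp (ξ : Idx m κ → (Idx m κ → ℝ) → Idx m κ → ℝ) (p : Idx m κ)
    (G : (Idx m κ → ℝ) → ℝ → ℝ) : (Idx m κ → ℝ) → ℝ → ℝ :=
  fun x t => ∑ q, ξ p x q * pd (fun v => G v t) q x

/-- The operator `X₀ G = ∂G/∂t + ξ₀^q ∂G/∂x_q`. -/
noncomputable def X0 (ξ0 : (Idx m κ → ℝ) → ℝ → Idx m κ → ℝ)
    (G : (Idx m κ → ℝ) → ℝ → ℝ) : (Idx m κ → ℝ) → ℝ → ℝ :=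
  fun x t => deriv (fun s => G x s) t + ∑ q, ξ0 x t q * pd (fun v => G v t) q x

/-- `∂f/∂η_p` for a function `f(η, x, t)`. -/
noncomputable def pEta (f : (Idx m κ → ℝ) → (Idx m κ → ℝ) → ℝ → ℝ) (p : Idx m κ)
    (η x : Idx m κ → ℝ) (t : ℝ) : ℝ :=
  pd (fun w => f w x t) p η

/-- `∂φ_α/∂η_j`. -/
noncomputable def dphi (φ : Fin κ → (Fin m → ℝ) → (Idx m κ → ℝ) → ℝ → ℝ)
    (α : Fin κ) (j : Fin m) (v : Fin m → ℝ) (x : Idx m κ → ℝ) (t : ℝ) : ℝ :=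
  pd (fun w => φ α w x t) j v

/-- The full vector of Poincaré parameters obtained from the independent ones
`v = (η_1,…,η_m)` by imposing the constraints `η_α = φ_α(v, x, t)`. -/
noncomputable def etaExt (φ : Fin κ → (Fin m → ℝ) → (Idx m κ → ℝ) → ℝ → ℝ)
    (v : Fin m → ℝ) (x : Idx m κ → ℝ) (t : ℝ) : Idx m κ → ℝ :=
  Sum.elim v fun α => φ α v x t

/-- `K_{0j}^s := C_{0j}^s + C_{0β}^s ∂φ_β/∂η_j`. -/
noncomputable def K0 (C0 : Idx m κ → Idx m κ → (Idx m κ → ℝ) → ℝ → ℝ)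
    (φ : Fin κ → (Fin m → ℝ) → (Idx m κ → ℝ) → ℝ → ℝ)
    (j : Fin m) (s : Idx m κ) (v : Fin m → ℝ) (x : Idx m κ → ℝ) (t : ℝ) : ℝ :=
  C0 (.inl j) s x t + ∑ β, C0 (.inr β) s x t * dphi φ β j v x t

/-- `K_{qj}^s := C_{qj}^s + C_{qβ}^s ∂φ_β/∂η_j`. -/
noncomputable def Kq (C : Idx m κ → Idx m κ → Idx m κ → (Idx m κ → ℝ) → ℝ → ℝ)
    (φ : Fin κ → (Fin m → ℝ) → (Idx m κ → ℝ) → ℝ → ℝ)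
    (q : Idx m κ) (j : Fin m) (s : Idx m κ) (v : Fin m → ℝ) (x : Idx m κ → ℝ) (t : ℝ) : ℝ :=
  C q (.inl j) s x t + ∑ β, C q (.inr β) s x t * dphi φ β j v x t

/-- `X*_j G := X_j G + (∂φ_β/∂η_j) X_β G`. -/
noncomputable def Xstar (ξ : Idx m κ → (Idx m κ → ℝ) → Idx m κ → ℝ)
    (φ : Fin κ → (Fin m → ℝ) → (Idx m κ → ℝ) → ℝ → ℝ)
    (j : Fin m) (G : (Idx m κ → ℝ) → ℝ → ℝ)
    (v : Fin m → ℝ) (x : Idx m κ → ℝ) (t : ℝ) : ℝ :=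
  Xp ξ (.inl j) G x t + ∑ β, dphi φ β j v x t * Xp ξ (.inr β) G x t

/-- The reduced Lagrangian `L*(η_1,…,η_m, x, t) = L(η_i, φ_α(η_i,x,t), x, t)`. -/
noncomputable def Lstar (L : (Idx m κ → ℝ) → (Idx m κ → ℝ) → ℝ → ℝ)
    (φ : Fin κ → (Fin m → ℝ) → (Idx m κ → ℝ) → ℝ → ℝ)
    (v : Fin m → ℝ) (x : Idx m κ → ℝ) (t : ℝ) : ℝ :=
  L (etaExt φ v x t) x t

/-- `∂L*/∂η_j`. -/
noncomputable def pLstar (L : (Idx m κ → ℝ) → (Idx m κ → ℝ) → ℝ → ℝ)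
    (φ : Fin κ → (Fin m → ℝ) → (Idx m κ → ℝ) → ℝ → ℝ)
    (j : Fin m) (v : Fin m → ℝ) (x : Idx m κ → ℝ) (t : ℝ) : ℝ :=
  pd (fun w => Lstar L φ w x t) j v

/-- `(A_j^α)*` along a motion `t ↦ (xc t)` with independent parameters `t ↦ vm t`. -/
noncomputable def Astar (ξ : Idx m κ → (Idx m κ → ℝ) → Idx m κ → ℝ)
    (C0 : Idx m κ → Idx m κ → (Idx m κ → ℝ) → ℝ → ℝ)
    (C : Idx m κ → Idx m κ → Idx m κ → (Idx m κ → ℝ) → ℝ → ℝ)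
    (φ : Fin κ → (Fin m → ℝ) → (Idx m κ → ℝ) → ℝ → ℝ)
    (xc : ℝ → Idx m κ → ℝ) (vm : ℝ → Fin m → ℝ)
    (j : Fin m) (α : Fin κ) (t : ℝ) : ℝ :=
  deriv (fun τ => dphi φ α j (vm τ) (xc τ) τ) t
    - Xstar ξ φ j (fun x' t' => φ α (vm t) x' t') (vm t) (xc t) t
    + K0 C0 φ j (.inr α) (vm t) (xc t) t
    + ∑ i, Kq C φ (.inl i) j (.inr α) (vm t) (xc t) t * vm t i
    + ∑ β, Kq C φ (.inr β) j (.inr α) (vm t) (xc t) t * φ β (vm t) (xc t) t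
    - ∑ k', (K0 C0 φ j (.inl k') (vm t) (xc t) t
        + ∑ i, Kq C φ (.inl i) j (.inl k') (vm t) (xc t) t * vm t i
        + ∑ β, Kq C φ (.inr β) j (.inl k') (vm t) (xc t) t * φ β (vm t) (xc t) t)
        * dphi φ α k' (vm t) (xc t) t

/-- Independent part of the Poincaré parameters of a motion. -/
noncomputable def vmOf (η : ℝ → Idx m κ → ℝ) (t : ℝ) : Fin m → ℝ := fun i => η t (.inl i)

/-- Left-hand side of the multiplier-free Poincaré equations of motion
`d/dt(∂L*/∂η_j) − (K_{0j}^k + K_{qj}^k η_q) ∂L*/∂η_k − X*_j L* − (A_j^α)* (∂L/∂η_α)*`. -/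
noncomputable def PoincareLHS (ξ : Idx m κ → (Idx m κ → ℝ) → Idx m κ → ℝ)
    (C0 : Idx m κ → Idx m κ → (Idx m κ → ℝ) → ℝ → ℝ)
    (C : Idx m κ → Idx m κ → Idx m κ → (Idx m κ → ℝ) → ℝ → ℝ)
    (φ : Fin κ → (Fin m → ℝ) → (Idx m κ → ℝ) → ℝ → ℝ)
    (L : (Idx m κ → ℝ) → (Idx m κ → ℝ) → ℝ → ℝ)
    (xc : ℝ → Idx m κ → ℝ) (η : ℝ → Idx m κ → ℝ)
    (j : Fin m) (t : ℝ) : ℝ :=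
  deriv (fun τ => pLstar L φ j (vmOf η τ) (xc τ) τ) t
    - ∑ k', (K0 C0 φ j (.inl k') (vmOf η t) (xc t) t
        + ∑ q, Kq C φ q j (.inl k') (vmOf η t) (xc t) t * η t q)
        * pLstar L φ k' (vmOf η t) (xc t) t
    - Xstar ξ φ j (fun x' t' => Lstar L φ (vmOf η t) x' t') (vmOf η t) (xc t) t
    - ∑ α, Astar ξ C0 C φ xc (vmOf η) j α t
        * pEta L (.inr α) (etaExt φ (vmOf η t) (xc t) t) (xc t) t

/-- The reduced Hamiltonian `H*(x, y*, t) := η_j y*_j − L*`, where `ηhat`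
inverts the Legendre transformation `y*_j = ∂L*/∂η_j`. -/
noncomputable def Hstar (L : (Idx m κ → ℝ) → (Idx m κ → ℝ) → ℝ → ℝ)
    (φ : Fin κ → (Fin m → ℝ) → (Idx m κ → ℝ) → ℝ → ℝ)
    (ηhat : (Idx m κ → ℝ) → (Fin m → ℝ) → ℝ → Fin m → ℝ)
    (x : Idx m κ → ℝ) (y : Fin m → ℝ) (t : ℝ) : ℝ :=
  (∑ j, ηhat x y t j * y j) - Lstar L φ (ηhat x y t) x t


section Calculus

variable {ι Y : Type*} [Fintype ι] [NormedAddCommGroup Y] [NormedSpace ℝ Y]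

theorem hasFDerivAt_left {F : (ι → ℝ) × Y → ℝ} (hF : Differentiable ℝ F) (v : ι → ℝ) (y : Y) :
    HasFDerivAt (fun w => F (w, y))
      ((fderiv ℝ F (v, y)).comp (ContinuousLinearMap.inl ℝ (ι → ℝ) Y)) v :=
  (hF (v, y)).hasFDerivAt.comp v (hasFDerivAt_prodMk_left v y)

variable [DecidableEq ι]

/-- The coordinate partial derivative of a differentiable function is the Fréchet derivative
applied to a basis vector. -/
theorem pd_eq_fderiv {f : (ι → ℝ) → ℝ} {v : ι → ℝ} (hf : DifferentiableAt ℝ f v) (i : ι) :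
    pd f i v = fderiv ℝ f v (Pi.single i 1) := by
  have hf' : HasFDerivAt f (fderiv ℝ f v) (Function.update v i (v i)) := by
    simpa using hf.hasFDerivAt
  exact (hf'.comp_hasDerivAt (v i) (hasDerivAt_update v i (v i))).deriv

theorem sum_mul_pd {f : (ι → ℝ) → ℝ} {v : ι → ℝ} (hf : DifferentiableAt ℝ f v) (w : ι → ℝ) :
    ∑ i, w i * pd f i v = fderiv ℝ f v w := by
  conv_rhs => rw [pi_eq_sum_univ' w, map_sum]
  simp [pd_eq_fderiv hf]

theorem pd_left_eq_fderiv {F : (ι → ℝ) × Y → ℝ} (hF : Differentiable ℝ F) (i : ι)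
    (v : ι → ℝ) (y : Y) :
    pd (fun w => F (w, y)) i v = fderiv ℝ F (v, y) (Pi.single i 1, 0) := by
  rw [pd_eq_fderiv (hasFDerivAt_left hF v y).differentiableAt, (hasFDerivAt_left hF v y).fderiv]
  simp

theorem contDiff_pd_left {F : (ι → ℝ) × Y → ℝ} (hF : ContDiff ℝ 2 F) (i : ι) :
    ContDiff ℝ 1 fun z : (ι → ℝ) × Y => pd (fun w => F (w, z.2)) i z.1 := by
  simp only [pd_left_eq_fderiv (hF.differentiable two_ne_zero)]
  exact (hF.fderiv_right (m := 1) (by norm_num)).clm_apply contDiff_const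

/-- The coefficients of a smooth vector in a smooth frame are smooth. -/
theorem contDiff_frame_coeff {n : WithTop ℕ∞} {ξ : ι → Y → ι → ℝ} {b : Y → ι → ℝ} {c : ι → Y → ℝ}
    (hξ : ∀ p, ContDiff ℝ n (ξ p)) (hb : ContDiff ℝ n b)
    (hind : ∀ y, LinearIndependent ℝ fun p => ξ p y)
    (hc : ∀ y, ∑ q, c q y • ξ q y = b y) (p : ι) : ContDiff ℝ n (c p) := by
  have hdet : ∀ B : Y → Matrix ι ι ℝ, (∀ i j, ContDiff ℝ n fun y => B y i j) →
      ContDiff ℝ n fun y => (B y).det := by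
    intro B hB
    simp only [Matrix.det_apply]
    exact ContDiff.sum fun σ _ => (contDiff_prod fun i _ => hB _ _).const_smul _
  let M : Y → Matrix ι ι ℝ := fun y => Matrix.of fun i q => ξ q y i
  have hM : ∀ i j, ContDiff ℝ n fun y => M y i j := fun i j => contDiff_pi.mp (hξ j) i
  have hunit : ∀ y, (M y).det ≠ 0 := fun y => by
    have : IsUnit (M y) := Matrix.linearIndependent_cols_iff_isUnit.mp (hind y)
    exact ((Matrix.isUnit_iff_isUnit_det _).mp this).ne_zero
  have hMc : ∀ y, (M y).mulVec (fun q => c q y) = b y := fun y => by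
    rw [← hc y]
    ext i
    simp [M, Matrix.mulVec, dotProduct, mul_comm]
  have key : c p = fun y => ((M y).updateCol p (b y)).det / (M y).det := by
    ext y
    rw [eq_div_iff (hunit y), ← Matrix.cramer_apply, ← hMc y, Matrix.cramer_eq_adjugate_mulVec,
      Matrix.mulVec_mulVec, Matrix.adjugate_mul, Matrix.smul_mulVec, Matrix.one_mulVec]
    simp [mul_comm]
  rw [key]
  refine (hdet _ fun i j => ?_).div (hdet _ hM) hunit
  by_cases h : j = p
  · subst h
    simpa [Matrix.updateCol_apply] using contDiff_pi.mp hb i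
  · simpa [Matrix.updateCol_apply, h] using hM i j

end Calculus

section Frame

variable {ξ : Idx m κ → (Idx m κ → ℝ) → Idx m κ → ℝ} {ξ0 : (Idx m κ → ℝ) → ℝ → Idx m κ → ℝ}
  {C0 : Idx m κ → Idx m κ → (Idx m κ → ℝ) → ℝ → ℝ}
  {C : Idx m κ → Idx m κ → Idx m κ → (Idx m κ → ℝ) → ℝ → ℝ}

theorem Xp_eq_fderiv {p : Idx m κ} {G : (Idx m κ → ℝ) → ℝ → ℝ} {x : Idx m κ → ℝ} {t : ℝ}
    (hG : DifferentiableAt ℝ (fun v => G v t) x) :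
    Xp ξ p G x t = fderiv ℝ (fun v => G v t) x (ξ p x) :=
  sum_mul_pd hG _

theorem Xp_coord (p r : Idx m κ) :
    Xp ξ p (fun v _ => v r) = fun x _ => ξ p x r := by
  ext x t
  rw [Xp_eq_fderiv (by fun_prop), (hasFDerivAt_apply r x).fderiv]
  rfl

theorem X0_coord (r : Idx m κ) :
    X0 ξ0 (fun v _ => v r) = fun x t => ξ0 x t r := by
  ext x t
  rw [X0, sum_mul_pd (f := fun v => v r) (by fun_prop), (hasFDerivAt_apply r x).fderiv]
  simp

theorem fderiv_coord {E : Type*} [NormedAddCommGroup E] [NormedSpace ℝ E]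
    {f : E → Idx m κ → ℝ} {x : E} (hf : DifferentiableAt ℝ f x) (r : Idx m κ) (w : E) :
    fderiv ℝ (fun v => f v r) x w = fderiv ℝ f x w r := by
  rw [((hasFDerivAt_pi'.mp hf.hasFDerivAt) r).fderiv]
  rfl

theorem frame_bracket (hξ : ∀ p, Differentiable ℝ (ξ p))
    (hcomm : ∀ p q (G : (Idx m κ → ℝ) → ℝ → ℝ),
      ContDiff ℝ 2 (fun z : (Idx m κ → ℝ) × ℝ => G z.1 z.2) →
      ∀ x t, Xp ξ p (Xp ξ q G) x t - Xp ξ q (Xp ξ p G) x t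
        = ∑ r, C p q r x t * Xp ξ r G x t) (p q : Idx m κ) (x : Idx m κ → ℝ) (t : ℝ) :
    fderiv ℝ (ξ q) x (ξ p x) - fderiv ℝ (ξ p) x (ξ q x) = ∑ r, C p q r x t • ξ r x := by
  ext r
  have h := hcomm p q (fun v _ => v r) (by fun_prop) x t
  have hd : ∀ p, DifferentiableAt ℝ (fun v => ξ p v r) x := fun p =>
    differentiableAt_pi.mp (hξ p x) r
  simp only [Xp_coord] at h
  rw [Xp_eq_fderiv (hd q), Xp_eq_fderiv (hd p), fderiv_coord (hξ q x), fderiv_coord (hξ p x)] at h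
  simpa using h

theorem drift_bracket (hξ : ∀ p, Differentiable ℝ (ξ p))
    (hξ0 : Differentiable ℝ (fun z : (Idx m κ → ℝ) × ℝ => ξ0 z.1 z.2))
    (hcomm0 : ∀ p (G : (Idx m κ → ℝ) → ℝ → ℝ),
      ContDiff ℝ 2 (fun z : (Idx m κ → ℝ) × ℝ => G z.1 z.2) →
      ∀ x t, X0 ξ0 (Xp ξ p G) x t - Xp ξ p (X0 ξ0 G) x t
        = ∑ q, C0 p q x t * Xp ξ q G x t) (p : Idx m κ) (x : Idx m κ → ℝ) (t : ℝ) :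
    fderiv ℝ (ξ p) x (ξ0 x t) - fderiv ℝ (fun v => ξ0 v t) x (ξ p x)
      = ∑ q, C0 p q x t • ξ q x := by
  ext r
  have h := hcomm0 p (fun v _ => v r) (by fun_prop) x t
  have hd : DifferentiableAt ℝ (fun v => ξ p v r) x := differentiableAt_pi.mp (hξ p x) r
  have hs : DifferentiableAt ℝ (fun v => ξ0 v t) x := by
    exact (hξ0 (x, t)).comp x (f := fun v => (v, t)) (by fun_prop)
  simp only [Xp_coord, X0_coord] at h
  rw [Xp_eq_fderiv (differentiableAt_pi.mp hs r), X0, sum_mul_pd hd, fderiv_coord (hξ p x),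
    fderiv_coord hs] at h
  simpa using h

/-- The transposition relations `δη_p = dω_p/dt + C_{0q}^p ω_q + C_{sq}^p η_s ω_q`. -/
theorem transposition_relation (hξ : ∀ p, Differentiable ℝ (ξ p))
    (hξ0 : Differentiable ℝ (fun z : (Idx m κ → ℝ) × ℝ => ξ0 z.1 z.2))
    (hind : ∀ x : Idx m κ → ℝ, LinearIndependent ℝ fun p => ξ p x)
    (hcomm0 : ∀ p (G : (Idx m κ → ℝ) → ℝ → ℝ),
      ContDiff ℝ 2 (fun z : (Idx m κ → ℝ) × ℝ => G z.1 z.2) →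
      ∀ x t, X0 ξ0 (Xp ξ p G) x t - Xp ξ p (X0 ξ0 G) x t
        = ∑ q, C0 p q x t * Xp ξ q G x t)
    (hcomm : ∀ p q (G : (Idx m κ → ℝ) → ℝ → ℝ),
      ContDiff ℝ 2 (fun z : (Idx m κ → ℝ) × ℝ => G z.1 z.2) →
      ∀ x t, Xp ξ p (Xp ξ q G) x t - Xp ξ q (Xp ξ p G) x t
        = ∑ r, C p q r x t * Xp ξ r G x t)
    {x : ℝ × ℝ → Idx m κ → ℝ} (hx : ContDiff ℝ 2 x) {η ω : Idx m κ → ℝ × ℝ → ℝ}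
    (hηd : ∀ p, Differentiable ℝ (η p)) (hωd : ∀ p, Differentiable ℝ (ω p))
    (hη : ∀ z, fderiv ℝ x z (1, 0) = ξ0 (x z) z.1 + ∑ q, η q z • ξ q (x z))
    (hω : ∀ z, fderiv ℝ x z (0, 1) = ∑ q, ω q z • ξ q (x z)) (z : ℝ × ℝ) (p : Idx m κ) :
    fderiv ℝ (η p) z (0, 1) = fderiv ℝ (ω p) z (1, 0)
      + ∑ q, ω q z * C0 q p (x z) z.1 + ∑ q, ω q z * ∑ s, C s q p (x z) z.1 * η s z := by
  have hxd : HasFDerivAt x (fderiv ℝ x z) z := (hx.differentiable two_ne_zero z).hasFDerivAt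
  have hfd : DifferentiableAt ℝ (fderiv ℝ x) z :=
    ((hx.fderiv_right (m := 1) (by norm_num)).differentiable one_ne_zero) z
  have hsymm : fderiv ℝ (fderiv ℝ x) z (0, 1) (1, 0) = fderiv ℝ (fderiv ℝ x) z (1, 0) (0, 1) :=
    (hx.contDiffAt (x := z)).isSymmSndFDerivAt (by simp) (0, 1) (1, 0)
  have hframe : ∀ (c : Idx m κ → ℝ × ℝ → ℝ), (∀ p, Differentiable ℝ (c p)) →
      HasFDerivAt (fun z => ∑ q, c q z • ξ q (x z))
        (∑ q, (c q z • (fderiv ℝ (ξ q) (x z)).comp (fderiv ℝ x z)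
          + (fderiv ℝ (c q) z).smulRight (ξ q (x z)))) z := by
    intro c hc
    refine HasFDerivAt.fun_sum fun q _ => ?_
    exact (hc q z).hasFDerivAt.smul ((hξ q (x z)).hasFDerivAt.comp z hxd)
  have hdrift : HasFDerivAt (fun z : ℝ × ℝ => ξ0 (x z) z.1)
      ((fderiv ℝ (fun z : (Idx m κ → ℝ) × ℝ => ξ0 z.1 z.2) (x z, z.1)).comp
        ((fderiv ℝ x z).prod (ContinuousLinearMap.fst ℝ ℝ ℝ))) z :=
    HasFDerivAt.comp (g := fun z : (Idx m κ → ℝ) × ℝ => ξ0 z.1 z.2) (f := fun z => (x z, z.1)) z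
      (hξ0 (x z, z.1)).hasFDerivAt (hxd.prodMk hasFDerivAt_fst)
  have hslice : ∀ w, fderiv ℝ (fun z : (Idx m κ → ℝ) × ℝ => ξ0 z.1 z.2) (x z, z.1) (w, 0)
      = fderiv ℝ (fun v => ξ0 v z.1) (x z) w := by
    intro w
    have := HasFDerivAt.comp (g := fun z : (Idx m κ → ℝ) × ℝ => ξ0 z.1 z.2)
      (f := fun v => (v, z.1)) (x z) (hξ0 (x z, z.1)).hasFDerivAt
      (hasFDerivAt_prodMk_left (x z) z.1)
    rw [show (fun v => ξ0 v z.1) = (fun z : (Idx m κ → ℝ) × ℝ => ξ0 z.1 z.2) ∘ fun v => (v, z.1)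
      from rfl, this.fderiv]
    simp
  have h1 : fderiv ℝ (fderiv ℝ x) z (0, 1) (1, 0)
      = fderiv ℝ (fun v => ξ0 v z.1) (x z) (∑ q, ω q z • ξ q (x z))
        + ∑ q, (η q z • fderiv ℝ (ξ q) (x z) (∑ q, ω q z • ξ q (x z))
          + fderiv ℝ (η q) z (0, 1) • ξ q (x z)) := by
    have ha := (hfd.hasFDerivAt.clm_apply
      (hasFDerivAt_const ((1 : ℝ), (0 : ℝ)) z)).congr_of_eventuallyEq
      (Filter.Eventually.of_forall fun z => (hη z).symm)
    have hb := DFunLike.congr_fun (ha.unique (hdrift.add (hframe η hηd))) ((0 : ℝ), (1 : ℝ))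
    simpa [hω, hslice] using hb
  have h2 : fderiv ℝ (fderiv ℝ x) z (1, 0) (0, 1)
      = ∑ q, (ω q z • fderiv ℝ (ξ q) (x z) (ξ0 (x z) z.1 + ∑ q, η q z • ξ q (x z))
          + fderiv ℝ (ω q) z (1, 0) • ξ q (x z)) := by
    have ha := (hfd.hasFDerivAt.clm_apply
      (hasFDerivAt_const ((0 : ℝ), (1 : ℝ)) z)).congr_of_eventuallyEq
      (Filter.Eventually.of_forall fun z => (hω z).symm)
    have hb := DFunLike.congr_fun (ha.unique (hframe ω hωd)) ((1 : ℝ), (0 : ℝ))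
    simpa [hη] using hb
  have h3 : ∑ p, fderiv ℝ (η p) z (0, 1) • ξ p (x z) = ∑ p, fderiv ℝ (ω p) z (1, 0) • ξ p (x z)
      + ∑ q, ω q z • ∑ p, C0 q p (x z) z.1 • ξ p (x z)
      + ∑ q, ω q z • ∑ s, η s z • ∑ p, C s q p (x z) z.1 • ξ p (x z) := by
    simp only [← frame_bracket hξ hcomm, ← drift_bracket hξ hξ0 hcomm0]
    rw [h1, h2] at hsymm
    simp only [map_add, map_sum, map_smul, Finset.sum_add_distrib, smul_add, Finset.smul_sum,
      smul_sub, Finset.sum_sub_distrib] at hsymm ⊢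
    have hswap : ∑ q, ∑ s, ω q z • η s z • fderiv ℝ (ξ s) (x z) (ξ q (x z))
        = ∑ s, ∑ q, η s z • ω q z • fderiv ℝ (ξ s) (x z) (ξ q (x z)) := by
      rw [Finset.sum_comm]
      exact Finset.sum_congr rfl fun s _ => Finset.sum_congr rfl fun q _ => smul_comm _ _ _
    rw [hswap]
    linear_combination hsymm
  have h4 : ∑ p, fderiv ℝ (η p) z (0, 1) • ξ p (x z) = ∑ p, (fderiv ℝ (ω p) z (1, 0)
      + ∑ q, ω q z * C0 q p (x z) z.1
      + ∑ q, ω q z * ∑ s, C s q p (x z) z.1 * η s z) • ξ p (x z) := by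
    rw [h3]
    simp only [add_smul, Finset.sum_add_distrib, Finset.sum_smul, Finset.smul_sum, smul_smul,
      Finset.mul_sum]
    congr 1
    · congr 1
      rw [Finset.sum_comm]
    · rw [eq_comm, Finset.sum_comm]
      refine Finset.sum_congr rfl fun q _ => ?_
      rw [Finset.sum_comm]
      simp only [mul_comm (C _ _ _ _ _)]
  have h5 := (Fintype.linearIndependent_iff.mp (hind (x z))) (fun p => fderiv ℝ (η p) z (0, 1)
      - (fderiv ℝ (ω p) z (1, 0) + ∑ q, ω q z * C0 q p (x z) z.1
        + ∑ q, ω q z * ∑ s, C s q p (x z) z.1 * η s z)) (by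
    simp only [sub_smul, Finset.sum_sub_distrib]
    rw [h4, sub_self]) p
  exact sub_eq_zero.mp h5

end Frame

section Reduced

variable {ξ : Idx m κ → (Idx m κ → ℝ) → Idx m κ → ℝ}
  {φ : Fin κ → (Fin m → ℝ) → (Idx m κ → ℝ) → ℝ → ℝ}
  {L : (Idx m κ → ℝ) → (Idx m κ → ℝ) → ℝ → ℝ}

theorem contDiff_Lstar
    (hφ : ∀ α, ContDiff ℝ 2
      (fun z : (Fin m → ℝ) × (Idx m κ → ℝ) × ℝ => φ α z.1 z.2.1 z.2.2))
    (hL : ContDiff ℝ 2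
      (fun z : (Idx m κ → ℝ) × (Idx m κ → ℝ) × ℝ => L z.1 z.2.1 z.2.2)) :
    ContDiff ℝ 2 (fun z : (Fin m → ℝ) × (Idx m κ → ℝ) × ℝ => Lstar L φ z.1 z.2.1 z.2.2) := by
  have he : ContDiff ℝ 2
      (fun z : (Fin m → ℝ) × (Idx m κ → ℝ) × ℝ => etaExt φ z.1 z.2.1 z.2.2) := by
    refine contDiff_pi.mpr fun p => ?_
    cases p with
    | inl i => exact (contDiff_apply ℝ ℝ i).comp contDiff_fst
    | inr α => exact hφ α
  exact hL.comp (he.prodMk contDiff_snd)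

/-- `∂L*/∂η_j = ∂L/∂η_j + (∂L/∂η_α) ∂φ_α/∂η_j`. -/
theorem pLstar_eq
    (hφ : ∀ α, ContDiff ℝ 2
      (fun z : (Fin m → ℝ) × (Idx m κ → ℝ) × ℝ => φ α z.1 z.2.1 z.2.2))
    (hL : ContDiff ℝ 2
      (fun z : (Idx m κ → ℝ) × (Idx m κ → ℝ) × ℝ => L z.1 z.2.1 z.2.2))
    (j : Fin m) (v : Fin m → ℝ) (x : Idx m κ → ℝ) (t : ℝ) :
    pLstar L φ j v x t = pEta L (.inl j) (etaExt φ v x t) x t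
      + ∑ α, dphi φ α j v x t * pEta L (.inr α) (etaExt φ v x t) x t := by
  have hφd : ∀ α, DifferentiableAt ℝ (fun w => φ α w x t) v := fun α =>
    (hasFDerivAt_left ((hφ α).differentiable two_ne_zero) v (x, t)).differentiableAt
  have hLd : DifferentiableAt ℝ (fun w => L w x t) (etaExt φ v x t) :=
    (hasFDerivAt_left (hL.differentiable two_ne_zero) (etaExt φ v x t) (x, t)).differentiableAt
  have he : HasFDerivAt (fun w => etaExt φ w x t)
      (ContinuousLinearMap.pi (Sum.elim (fun i => ContinuousLinearMap.proj i)
        fun α => fderiv ℝ (fun w => φ α w x t) v)) v := by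
    refine hasFDerivAt_pi.mpr fun p => ?_
    cases p with
    | inl i => exact hasFDerivAt_apply i v
    | inr α => exact (hφd α).hasFDerivAt
  have hc := HasFDerivAt.comp (g := fun w => L w x t) v hLd.hasFDerivAt he
  have hLs : (fun w => Lstar L φ w x t) = (fun w => L w x t) ∘ fun w => etaExt φ w x t := rfl
  rw [pLstar, hLs, pd_eq_fderiv hc.differentiableAt, hc.fderiv, ContinuousLinearMap.comp_apply,
    ← sum_mul_pd hLd, Fintype.sum_sum_type]
  simp [pEta, dphi, pd_eq_fderiv (hφd _), Pi.single_apply]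

/-- `X_p L* = X_p L + (∂L/∂η_α) X_p φ_α`. -/
theorem Xp_Lstar
    (hφ : ∀ α, ContDiff ℝ 2
      (fun z : (Fin m → ℝ) × (Idx m κ → ℝ) × ℝ => φ α z.1 z.2.1 z.2.2))
    (hL : ContDiff ℝ 2
      (fun z : (Idx m κ → ℝ) × (Idx m κ → ℝ) × ℝ => L z.1 z.2.1 z.2.2))
    (p : Idx m κ) (v : Fin m → ℝ) (x : Idx m κ → ℝ) (t : ℝ) :
    Xp ξ p (fun x' t' => Lstar L φ v x' t') x t
      = Xp ξ p (fun x' t' => L (etaExt φ v x t) x' t') x t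
        + ∑ α, pEta L (.inr α) (etaExt φ v x t) x t * Xp ξ p (fun x' t' => φ α v x' t') x t := by
  have hφd : ∀ α, DifferentiableAt ℝ (fun y => φ α v y t) x := fun α =>
    DifferentiableAt.comp (g := fun z : (Fin m → ℝ) × (Idx m κ → ℝ) × ℝ => φ α z.1 z.2.1 z.2.2)
      (f := fun y => (v, y, t)) x ((hφ α).differentiable two_ne_zero _) (by fun_prop)
  have hLd := hL.differentiable two_ne_zero (etaExt φ v x t, x, t)
  have hLw : DifferentiableAt ℝ (fun w => L w x t) (etaExt φ v x t) :=
    (hasFDerivAt_left (hL.differentiable two_ne_zero) (etaExt φ v x t) (x, t)).differentiableAt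
  have hins : HasFDerivAt (fun y : Idx m κ → ℝ => (y, t))
      (ContinuousLinearMap.inl ℝ (Idx m κ → ℝ) ℝ) x := hasFDerivAt_prodMk_left x t
  have he : HasFDerivAt (fun y => etaExt φ v y t)
      (ContinuousLinearMap.pi (Sum.elim (fun _ => 0) fun α => fderiv ℝ (fun y => φ α v y t) x)) x := by
    refine hasFDerivAt_pi.mpr fun p => ?_
    cases p with
    | inl i => exact hasFDerivAt_const _ _
    | inr α => exact (hφd α).hasFDerivAt
  have hs : HasFDerivAt (fun y => Lstar L φ v y t) _ x :=
    HasFDerivAt.comp (g := fun z : (Idx m κ → ℝ) × (Idx m κ → ℝ) × ℝ => L z.1 z.2.1 z.2.2)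
      (f := fun y => (etaExt φ v y t, y, t)) x hLd.hasFDerivAt (he.prodMk hins)
  have hx : HasFDerivAt (fun y => L (etaExt φ v x t) y t) _ x :=
    HasFDerivAt.comp (g := fun z : (Idx m κ → ℝ) × (Idx m κ → ℝ) × ℝ => L z.1 z.2.1 z.2.2)
      (f := fun y => (etaExt φ v x t, y, t)) x hLd.hasFDerivAt
      ((hasFDerivAt_const (etaExt φ v x t) x).prodMk hins)
  have hw := (hasFDerivAt_left (hL.differentiable two_ne_zero) (etaExt φ v x t) (x, t)).fderiv
  rw [Xp_eq_fderiv hs.differentiableAt, Xp_eq_fderiv hx.differentiableAt, hs.fderiv, hx.fderiv]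
  have hsum := sum_mul_pd hLw (Sum.elim (fun _ => 0) fun α => fderiv ℝ (fun y => φ α v y t) x (ξ p x))
  rw [Fintype.sum_sum_type, hw] at hsum
  simp only [Sum.elim_inl, Sum.elim_inr, zero_mul, Finset.sum_const_zero, zero_add] at hsum
  simp only [Xp_eq_fderiv (hφd _), pEta, mul_comm (pd _ _ _), hsum, ContinuousLinearMap.comp_apply]
  rw [← map_add]
  congr 1
  ext q
  · cases q <;> simp
  · simp
  · simp

theorem Xstar_Lstar
    (hφ : ∀ α, ContDiff ℝ 2
      (fun z : (Fin m → ℝ) × (Idx m κ → ℝ) × ℝ => φ α z.1 z.2.1 z.2.2))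
    (hL : ContDiff ℝ 2
      (fun z : (Idx m κ → ℝ) × (Idx m κ → ℝ) × ℝ => L z.1 z.2.1 z.2.2))
    (j : Fin m) (v : Fin m → ℝ) (x : Idx m κ → ℝ) (t : ℝ) :
    Xstar ξ φ j (fun x' t' => Lstar L φ v x' t') v x t
      = Xstar ξ φ j (fun x' t' => L (etaExt φ v x t) x' t') v x t
        + ∑ α, pEta L (.inr α) (etaExt φ v x t) x t
          * Xstar ξ φ j (fun x' t' => φ α v x' t') v x t := by
  simp only [Xstar, Xp_Lstar hφ hL, mul_add, Finset.sum_add_distrib, Finset.mul_sum]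
  rw [Finset.sum_comm (γ := Fin κ)]
  simp only [mul_left_comm]
  ring

theorem contDiff_pLstar
    (hφ : ∀ α, ContDiff ℝ 2
      (fun z : (Fin m → ℝ) × (Idx m κ → ℝ) × ℝ => φ α z.1 z.2.1 z.2.2))
    (hL : ContDiff ℝ 2
      (fun z : (Idx m κ → ℝ) × (Idx m κ → ℝ) × ℝ => L z.1 z.2.1 z.2.2)) (j : Fin m) :
    ContDiff ℝ 1
      (fun z : (Fin m → ℝ) × (Idx m κ → ℝ) × ℝ => pLstar L φ j z.1 z.2.1 z.2.2) :=
  contDiff_pd_left (contDiff_Lstar hφ hL) j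

theorem contDiff_dphi
    (hφ : ∀ α, ContDiff ℝ 2
      (fun z : (Fin m → ℝ) × (Idx m κ → ℝ) × ℝ => φ α z.1 z.2.1 z.2.2)) (α : Fin κ) (j : Fin m) :
    ContDiff ℝ 1
      (fun z : (Fin m → ℝ) × (Idx m κ → ℝ) × ℝ => dphi φ α j z.1 z.2.1 z.2.2) :=
  contDiff_pd_left (hφ α) j

end Reduced

section Algebra

theorem sum_admissible {ω : Idx m κ → ℝ} {D : Fin κ → Fin m → ℝ}
    (hω : ∀ α, ω (.inr α) = ∑ i, D α i * ω (.inl i)) (a : Idx m κ → ℝ) :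
    ∑ q, ω q * a q = ∑ j, ω (.inl j) * (a (.inl j) + ∑ β, D β j * a (.inr β)) := by
  rw [Fintype.sum_sum_type]
  simp only [hω, mul_add, Finset.sum_add_distrib, Finset.sum_mul, Finset.mul_sum]
  rw [Finset.sum_comm (γ := Fin κ)]
  simp only [mul_left_comm, mul_assoc]

/-- The algebraic core of the passage to the multiplier-free equations: `lam p` stands for
`∂L/∂η_p`, `P` for `∂L*/∂η`, `D` for `∂φ/∂η`, `K j s` for `K_{0j}^s + K_{qj}^s η_q`, and the
suffix `d` for a time derivative. -/
theorem reduced_variation {lam δ ωd : Idx m κ → ℝ} {ω P Pd XL : Fin m → ℝ} {K : Fin m → Idx m κ → ℝ}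
    {D Dd : Fin κ → Fin m → ℝ} {Xφ : Fin m → Fin κ → ℝ}
    (hδ : ∀ p, δ p = ωd p + ∑ j, ω j * K j p)
    (hωd : ∀ α, ωd (.inr α) = ∑ j, (Dd α j * ω j + D α j * ωd (.inl j)))
    (hP : ∀ j, P j = lam (.inl j) + ∑ α, D α j * lam (.inr α)) :
    ∑ p, lam p * δ p + ∑ j, ω j * XL j
      = ∑ j, (Pd j * ω j + P j * ωd (.inl j))
        - ∑ j, (Pd j - ∑ k, K j (.inl k) * P k - (XL j + ∑ α, lam (.inr α) * Xφ j α)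
          - ∑ α, (Dd α j - Xφ j α + K j (.inr α) - ∑ k, K j (.inl k) * D α k) * lam (.inr α))
            * ω j := by
  have hterm : ∀ j, (Pd j * ω j + P j * ωd (.inl j))
        - (Pd j - ∑ k, K j (.inl k) * P k - (XL j + ∑ α, lam (.inr α) * Xφ j α)
          - ∑ α, (Dd α j - Xφ j α + K j (.inr α) - ∑ k, K j (.inl k) * D α k) * lam (.inr α)) * ω j
      = lam (.inl j) * ωd (.inl j) + ∑ α, lam (.inr α) * (Dd α j * ω j + D α j * ωd (.inl j))
        + ∑ p, lam p * (ω j * K j p) + ω j * XL j := by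
    intro j
    have hsplit : ∑ k, K j (.inl k) * P k = ∑ k, K j (.inl k) * lam (.inl k)
        + ∑ α, (∑ k, K j (.inl k) * D α k) * lam (.inr α) := by
      simp only [hP, mul_add, Finset.sum_add_distrib, Finset.mul_sum, Finset.sum_mul]
      rw [Finset.sum_comm (γ := Fin κ)]
      simp only [mul_assoc]
    have h1 : ∑ p, lam p * (ω j * K j p) = (∑ k, K j (.inl k) * lam (.inl k)
        + ∑ α, K j (.inr α) * lam (.inr α)) * ω j := by
      rw [Fintype.sum_sum_type]
      simp only [add_mul, Finset.sum_mul]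
      congr 1 <;> exact Finset.sum_congr rfl fun _ _ => by ring
    have h2 : ∑ α, lam (.inr α) * (Dd α j * ω j + D α j * ωd (.inl j))
        = (∑ α, Dd α j * lam (.inr α)) * ω j + (∑ α, D α j * lam (.inr α)) * ωd (.inl j) := by
      simp only [Finset.sum_mul, ← Finset.sum_add_distrib]
      exact Finset.sum_congr rfl fun _ _ => by ring
    rw [hsplit, h1, h2, hP]
    simp only [add_mul, sub_mul, Finset.sum_add_distrib, Finset.sum_sub_distrib,
      mul_comm (lam _) (Xφ _ _)]
    ring
  rw [← Finset.sum_sub_distrib, Finset.sum_congr rfl fun j _ => hterm j]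
  simp only [Finset.sum_add_distrib, hδ, mul_add]
  congr 1
  congr 1
  · rw [Fintype.sum_sum_type]
    simp only [hωd, Finset.mul_sum, Finset.sum_add_distrib, mul_add]
    rw [Finset.sum_comm (γ := Fin κ), Finset.sum_comm (γ := Fin κ)]
  · simp only [Finset.mul_sum]
    rw [Finset.sum_comm]

end Algebra

section Family

theorem hasDerivAt_left {F : Type*} [NormedAddCommGroup F] [NormedSpace ℝ F] {f : ℝ × ℝ → F}
    (hf : Differentiable ℝ f) (t ε : ℝ) :
    HasDerivAt (fun τ => f (τ, ε)) (fderiv ℝ f (t, ε) (1, 0)) t :=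
  (hf (t, ε)).hasFDerivAt.comp_hasDerivAt t ((hasDerivAt_id t).prodMk (hasDerivAt_const t ε))

theorem hasDerivAt_right {F : Type*} [NormedAddCommGroup F] [NormedSpace ℝ F] {f : ℝ × ℝ → F}
    (hf : Differentiable ℝ f) (t ε : ℝ) :
    HasDerivAt (fun e => f (t, e)) (fderiv ℝ f (t, ε) (0, 1)) ε :=
  (hf (t, ε)).hasFDerivAt.comp_hasDerivAt ε ((hasDerivAt_const ε t).prodMk (hasDerivAt_id ε))

/-- At an instant where the constraints, the Chetaev conditions with their time derivative, and
the transposition relations hold, the integrand of the first variation is the time derivative of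
`(∂L*/∂η_j) ω_j` minus the left-hand side of the Poincaré equations contracted with `ω_j`. -/
theorem first_variation_integrand {ξ : Idx m κ → (Idx m κ → ℝ) → Idx m κ → ℝ}
    {C0 : Idx m κ → Idx m κ → (Idx m κ → ℝ) → ℝ → ℝ}
    {C : Idx m κ → Idx m κ → Idx m κ → (Idx m κ → ℝ) → ℝ → ℝ}
    {φ : Fin κ → (Fin m → ℝ) → (Idx m κ → ℝ) → ℝ → ℝ}
    {L : (Idx m κ → ℝ) → (Idx m κ → ℝ) → ℝ → ℝ}
    (hφ : ∀ α, ContDiff ℝ 2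
      (fun z : (Fin m → ℝ) × (Idx m κ → ℝ) × ℝ => φ α z.1 z.2.1 z.2.2))
    (hL : ContDiff ℝ 2
      (fun z : (Idx m κ → ℝ) × (Idx m κ → ℝ) × ℝ => L z.1 z.2.1 z.2.2))
    {xc η : ℝ → Idx m κ → ℝ} {t : ℝ} {ω ωd δ : Idx m κ → ℝ}
    (hcon : ∀ α, η t (.inr α) = φ α (vmOf η t) (xc t) t)
    (hω : ∀ α, ω (.inr α) = ∑ i, dphi φ α i (vmOf η t) (xc t) t * ω (.inl i))
    (hωd : ∀ α, ωd (.inr α) = ∑ j, (deriv (fun τ => dphi φ α j (vmOf η τ) (xc τ) τ) t * ω (.inl j)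
      + dphi φ α j (vmOf η t) (xc t) t * ωd (.inl j)))
    (hδ : ∀ p, δ p = ωd p + ∑ q, ω q * C0 q p (xc t) t
      + ∑ q, ω q * ∑ s, C s q p (xc t) t * η t s) :
    ∑ p, pEta L p (η t) (xc t) t * δ p
        + ∑ p, ω p * Xp ξ p (fun x' t' => L (η t) x' t') (xc t) t
      = ∑ j, (deriv (fun τ => pLstar L φ j (vmOf η τ) (xc τ) τ) t * ω (.inl j)
          + pLstar L φ j (vmOf η t) (xc t) t * ωd (.inl j))
        - ∑ j, PoincareLHS ξ C0 C φ L xc η j t * ω (.inl j) := by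
  have hext : etaExt φ (vmOf η t) (xc t) t = η t := by
    ext p
    cases p with
    | inl i => rfl
    | inr α => exact (hcon α).symm
  let K : Fin m → Idx m κ → ℝ := fun j s => K0 C0 φ j s (vmOf η t) (xc t) t
    + ∑ q, Kq C φ q j s (vmOf η t) (xc t) t * η t q
  have hK : ∀ p, δ p = ωd p + ∑ j, ω (.inl j) * K j p := by
    intro p
    rw [hδ, sum_admissible hω, sum_admissible hω, add_assoc, ← Finset.sum_add_distrib]
    congr 1
    refine Finset.sum_congr rfl fun j _ => ?_
    simp only [K, K0, Kq, add_mul, Finset.sum_add_distrib, Finset.mul_sum, Finset.sum_mul]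
    rw [Finset.sum_comm (γ := Fin κ)]
    simp only [mul_comm (C0 _ _ _ _), mul_left_comm _ (C _ _ _ _ _), mul_assoc]
    ring
  have hA : ∀ j α, Astar ξ C0 C φ xc (vmOf η) j α t
      = deriv (fun τ => dphi φ α j (vmOf η τ) (xc τ) τ) t
        - Xstar ξ φ j (fun x' t' => φ α (vmOf η t) x' t') (vmOf η t) (xc t) t
        + K j (.inr α) - ∑ k, K j (.inl k) * dphi φ α k (vmOf η t) (xc t) t := by
    intro j α
    simp only [Astar, K, Fintype.sum_sum_type (α₁ := Fin m) (α₂ := Fin κ), hcon, vmOf, add_assoc]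
  have hX := sum_admissible hω fun p => Xp ξ p (fun x' t' => L (η t) x' t') (xc t) t
  have key := reduced_variation (lam := fun p => pEta L p (η t) (xc t) t) (ω := fun j => ω (.inl j))
    (Pd := fun j => deriv (fun τ => pLstar L φ j (vmOf η τ) (xc τ) τ) t)
    (XL := fun j => Xstar ξ φ j (fun x' t' => L (η t) x' t') (vmOf η t) (xc t) t)
    (Xφ := fun j α => Xstar ξ φ j (fun x' t' => φ α (vmOf η t) x' t') (vmOf η t) (xc t) t)
    hK hωd fun j => by simpa only [hext] using pLstar_eq hφ hL j (vmOf η t) (xc t) t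
  rw [hX]
  simp only [PoincareLHS, Xstar_Lstar hφ hL, hA, hext]
  exact key

end Family

/-- **Statement 6 (Appendix, eq. (A.4)): first variation of the action.** -/
theorem first_variation_identity {m κ : ℕ}
    (ξ : Idx m κ → (Idx m κ → ℝ) → Idx m κ → ℝ)
    (ξ0 : (Idx m κ → ℝ) → ℝ → Idx m κ → ℝ)
    (C0 : Idx m κ → Idx m κ → (Idx m κ → ℝ) → ℝ → ℝ)
    (C : Idx m κ → Idx m κ → Idx m κ → (Idx m κ → ℝ) → ℝ → ℝ)
    (φ : Fin κ → (Fin m → ℝ) → (Idx m κ → ℝ) → ℝ → ℝ)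
    (L : (Idx m κ → ℝ) → (Idx m κ → ℝ) → ℝ → ℝ)
    (hξ : ∀ p, ContDiff ℝ 2 (ξ p))
    (hξ0 : ContDiff ℝ 2 (fun z : (Idx m κ → ℝ) × ℝ => ξ0 z.1 z.2))
    (hind : ∀ x : Idx m κ → ℝ, LinearIndependent ℝ fun p => ξ p x)
    (hφ : ∀ α, ContDiff ℝ 2
      (fun z : (Fin m → ℝ) × (Idx m κ → ℝ) × ℝ => φ α z.1 z.2.1 z.2.2))
    (hL : ContDiff ℝ 2
      (fun z : (Idx m κ → ℝ) × (Idx m κ → ℝ) × ℝ => L z.1 z.2.1 z.2.2))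
    (hcomm0 : ∀ p (G : (Idx m κ → ℝ) → ℝ → ℝ),
      ContDiff ℝ 2 (fun z : (Idx m κ → ℝ) × ℝ => G z.1 z.2) →
      ∀ x t, X0 ξ0 (Xp ξ p G) x t - Xp ξ p (X0 ξ0 G) x t
        = ∑ q, C0 p q x t * Xp ξ q G x t)
    (hcomm : ∀ p q (G : (Idx m κ → ℝ) → ℝ → ℝ),
      ContDiff ℝ 2 (fun z : (Idx m κ → ℝ) × ℝ => G z.1 z.2) →
      ∀ x t, Xp ξ p (Xp ξ q G) x t - Xp ξ q (Xp ξ p G) x t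
        = ∑ r, C p q r x t * Xp ξ r G x t)
    -- the C² two-parameter family and its Poincaré parameters
    (x : ℝ × ℝ → Idx m κ → ℝ) (hx : ContDiff ℝ 2 x)
    (η ω : Idx m κ → ℝ → ℝ → ℝ)
    (hη : ∀ p t ε, deriv (fun τ => x (τ, ε) p) t
      = ξ0 (x (t, ε)) t p + ∑ q, η q t ε * ξ q (x (t, ε)) p)
    (hω : ∀ p t ε, deriv (fun e => x (t, e) p) ε
      = ∑ q, ω q t ε * ξ q (x (t, ε)) p)
    (t₁ t₂ : ℝ) (ht : t₁ ≤ t₂)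
    -- the constraints hold along `ε = 0` on `[t₁, t₂]`
    (hcon : ∀ t ∈ Set.Icc t₁ t₂, ∀ α, η (.inr α) t 0
      = φ α (vmOf (fun τ q => η q τ 0) t) (x (t, 0)) t)
    -- the Chetaev conditions hold along `ε = 0` on `[t₁, t₂]`
    (hchetaev : ∀ t ∈ Set.Icc t₁ t₂, ∀ α, ω (.inr α) t 0
      = ∑ i, dphi φ α i (vmOf (fun τ q => η q τ 0) t) (x (t, 0)) t * ω (.inl i) t 0) :
    (∫ t in t₁..t₂,
        ((∑ p, pEta L p (fun r => η r t 0) (x (t, 0)) t * deriv (fun e => η p t e) 0)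
          + ∑ p, ω p t 0 * Xp ξ p (fun x' t' => L (fun r => η r t 0) x' t') (x (t, 0)) t))
      = ((∑ j, pLstar L φ j (vmOf (fun τ q => η q τ 0) t₂) (x (t₂, 0)) t₂ * ω (.inl j) t₂ 0)
          - ∑ j, pLstar L φ j (vmOf (fun τ q => η q τ 0) t₁) (x (t₁, 0)) t₁ * ω (.inl j) t₁ 0)
        - ∫ t in t₁..t₂,
            ∑ j, PoincareLHS ξ C0 C φ L (fun τ => x (τ, 0)) (fun τ q => η q τ 0) j t
              * ω (.inl j) t 0 := by

  have hxd := hx.differentiable two_ne_zero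
  have hx' : ContDiff ℝ 1 (fderiv ℝ x) := hx.fderiv_right (by norm_num)
  have hx1 : ContDiff ℝ 1 x := hx.of_le one_le_two
  let H : Idx m κ → ℝ × ℝ → ℝ := fun p z => η p z.1 z.2
  let W : Idx m κ → ℝ × ℝ → ℝ := fun p z => ω p z.1 z.2
  have hη' : ∀ z, fderiv ℝ x z (1, 0) = ξ0 (x z) z.1 + ∑ q, H q z • ξ q (x z) := by
    intro z
    ext p
    have h := (hasDerivAt_pi.mp (hasDerivAt_left hxd z.1 z.2) p).deriv
    rw [hη] at h
    simpa [H] using h.symm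
  have hω' : ∀ z, fderiv ℝ x z (0, 1) = ∑ q, W q z • ξ q (x z) := by
    intro z
    ext p
    have h := (hasDerivAt_pi.mp (hasDerivAt_right hxd z.1 z.2) p).deriv
    rw [hω] at h
    simpa [W] using h.symm
  have hξx : ∀ p, ContDiff ℝ 1 fun z => ξ p (x z) := fun p =>
    ((hξ p).of_le one_le_two).comp hx1
  have hξ0x : ContDiff ℝ 1 fun z : ℝ × ℝ => ξ0 (x z) z.1 :=
    (hξ0.of_le one_le_two).comp (hx1.prodMk contDiff_fst)
  have hH : ∀ p, ContDiff ℝ 1 (H p) := fun p =>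
    contDiff_frame_coeff hξx ((hx'.clm_apply contDiff_const).sub hξ0x) (fun z => hind (x z))
      (fun z => by rw [hη' z]; simp) p
  have hW : ∀ p, ContDiff ℝ 1 (W p) := fun p =>
    contDiff_frame_coeff hξx (hx'.clm_apply contDiff_const) (fun z => hind (x z))
      (fun z => (hω' z).symm) p
  have hHd : ∀ p, Differentiable ℝ (H p) := fun p => (hH p).differentiable one_ne_zero
  have hWd : ∀ p, Differentiable ℝ (W p) := fun p => (hW p).differentiable one_ne_zero
  have hline : ContDiff ℝ 1 fun t : ℝ => (t, (0 : ℝ)) := by fun_prop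
  have hxc : ContDiff ℝ 1 fun t : ℝ => x (t, 0) := hx1.comp hline
  have hηc : ContDiff ℝ 1 fun t : ℝ => fun r => η r t 0 :=
    contDiff_pi.mpr fun p => (hH p).comp hline
  have hωc : ∀ p, ContDiff ℝ 1 fun t : ℝ => ω p t 0 := fun p => (hW p).comp hline
  have hvm : ContDiff ℝ 1 fun t : ℝ =>
      (vmOf (fun τ q => η q τ 0) t, (x (t, 0), t)) :=
    (contDiff_pi.mpr fun i => (hH (.inl i)).comp hline).prodMk (hxc.prodMk contDiff_id)
  have hP : ∀ j, ContDiff ℝ 1 fun t => pLstar L φ j (vmOf (fun τ q => η q τ 0) t) (x (t, 0)) t :=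
    fun j => (contDiff_pLstar hφ hL j).comp hvm
  have hD : ∀ α j, ContDiff ℝ 1
      fun t => dphi φ α j (vmOf (fun τ q => η q τ 0) t) (x (t, 0)) t :=
    fun α j => (contDiff_dphi hφ α j).comp hvm
  have hδ : ∀ p t, deriv (fun e => η p t e) 0 = fderiv ℝ (H p) (t, 0) (0, 1) := fun p t =>
    (hasDerivAt_right (hHd p) t 0).deriv
  have hωd : ∀ p t, deriv (fun τ => ω p τ 0) t = fderiv ℝ (W p) (t, 0) (1, 0) := fun p t =>
    (hasDerivAt_left (hWd p) t 0).deriv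
  let B : ℝ → ℝ := fun t =>
    ∑ j, pLstar L φ j (vmOf (fun τ q => η q τ 0) t) (x (t, 0)) t * ω (.inl j) t 0
  have hB : ContDiff ℝ 1 B := ContDiff.sum fun j _ => (hP j).mul (hωc (.inl j))
  have hBint : ∫ t in t₁..t₂, deriv B t = B t₂ - B t₁ :=
    intervalIntegral.integral_eq_sub_of_hasDerivAt
      (fun t _ => (hB.differentiable one_ne_zero t).hasDerivAt)
      ((hB.continuous_deriv le_rfl).intervalIntegrable _ _)
  have hA : Continuous fun t =>
      (∑ p, pEta L p (fun r => η r t 0) (x (t, 0)) t * deriv (fun e => η p t e) 0)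
        + ∑ p, ω p t 0 * Xp ξ p (fun x' t' => L (fun r => η r t 0) x' t') (x (t, 0)) t := by
    refine (continuous_finsetSum _ fun p _ => ?_).add (continuous_finsetSum _ fun p _ => ?_)
    · refine Continuous.mul ?_ ?_
      · exact (contDiff_pd_left hL p).continuous.comp
          (hηc.prodMk (hxc.prodMk contDiff_id)).continuous
      · simp only [hδ]
        exact (((hH p).continuous_fderiv one_ne_zero).comp hline.continuous).clm_apply
          continuous_const
    · refine (hωc p).continuous.mul (continuous_finsetSum _ fun q _ => ?_)
      refine Continuous.mul ((continuous_pi_iff.mp ((hξx p).comp hline).continuous) q) ?_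
      have hL' : ContDiff ℝ 2
          (fun z : (Idx m κ → ℝ) × (Idx m κ → ℝ) × ℝ => L z.2.1 z.1 z.2.2) :=
        hL.comp (contDiff_snd.fst.prodMk (contDiff_fst.prodMk contDiff_snd.snd))
      exact (contDiff_pd_left hL' q).continuous.comp
        (hxc.prodMk (hηc.prodMk contDiff_id)).continuous
  have hpoint : ∀ t ∈ Set.Ioo t₁ t₂,
      ∑ j, PoincareLHS ξ C0 C φ L (fun τ => x (τ, 0)) (fun τ q => η q τ 0) j t * ω (.inl j) t 0
        = deriv B t
          - ((∑ p, pEta L p (fun r => η r t 0) (x (t, 0)) t * deriv (fun e => η p t e) 0)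
            + ∑ p, ω p t 0 * Xp ξ p (fun x' t' => L (fun r => η r t 0) x' t') (x (t, 0)) t) := by
    intro t htI
    have htC := Set.Ioo_subset_Icc_self htI
    have hBd : deriv B t
        = ∑ j, (deriv (fun τ => pLstar L φ j (vmOf (fun τ q => η q τ 0) τ) (x (τ, 0)) τ) t
            * ω (.inl j) t 0
          + pLstar L φ j (vmOf (fun τ q => η q τ 0) t) (x (t, 0)) t
            * deriv (fun τ => ω (.inl j) τ 0) t) :=
      (HasDerivAt.fun_sum fun j _ => ((hP j).differentiable one_ne_zero t).hasDerivAt.mul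
        ((hωc (.inl j)).differentiable one_ne_zero t).hasDerivAt).deriv
    have hωα : ∀ α, deriv (fun τ => ω (.inr α) τ 0) t
        = ∑ j, (deriv (fun τ => dphi φ α j (vmOf (fun τ q => η q τ 0) τ) (x (τ, 0)) τ) t
            * ω (.inl j) t 0
          + dphi φ α j (vmOf (fun τ q => η q τ 0) t) (x (t, 0)) t
            * deriv (fun τ => ω (.inl j) τ 0) t) := by
      intro α
      have heq : (fun τ => ω (.inr α) τ 0) =ᶠ[nhds t] fun τ =>
          ∑ i, dphi φ α i (vmOf (fun τ q => η q τ 0) τ) (x (τ, 0)) τ * ω (.inl i) τ 0 := by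
        filter_upwards [isOpen_Ioo.mem_nhds htI] with τ hτ
        exact hchetaev τ (Set.Ioo_subset_Icc_self hτ) α
      rw [heq.deriv_eq]
      exact (HasDerivAt.fun_sum fun j _ => ((hD α j).differentiable one_ne_zero t).hasDerivAt.mul
        ((hωc (.inl j)).differentiable one_ne_zero t).hasDerivAt).deriv
    have key := first_variation_integrand (ξ := ξ) (C0 := C0) (C := C) hφ hL
      (xc := fun τ => x (τ, 0)) (η := fun τ q => η q τ 0) (ω := fun p => ω p t 0)
      (ωd := fun p => deriv (fun τ => ω p τ 0) t) (δ := fun p => deriv (fun e => η p t e) 0)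
      (hcon t htC) (hchetaev t htC) hωα fun p => by
        simp only [hδ, hωd]
        exact transposition_relation (fun p => (hξ p).differentiable two_ne_zero)
          (hξ0.differentiable two_ne_zero) hind hcomm0 hcomm hx hHd hWd hη' hω' (t, 0) p
    rw [hBd, key]
    ring
  rw [intervalIntegral.integral_congr_Ioo_of_le ht hpoint, intervalIntegral.integral_sub
    ((hB.continuous_deriv le_rfl).intervalIntegrable _ _) (hA.intervalIntegrable _ _), hBint]
  ring

end NNH
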